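/- arXiv:2512.21829 — 3 statements merged into one kernel-verified Lean document; each statement's English description precedes it below -/
import Mathlib

section
/- The Gaussian-smoothed density p is strictly positive and continuously differentiable on ℝ^d, with gradient obtained by differentiating under the integral: ∇p(x) = ∫ ((β y − x)/α²) K(x, y) dρ₁(y) for every x ∈ ℝ^d. Consequently the score satisfies Tweedie's formula: ∇ log p(x) = (∫ ((β y − x)/α²) K(x, y) dρ₁(y)) / p(x), i.e. the score of the law of the interpolant I = α x₀ + β x₁ equals the conditional expectation of (β x₁ − x)/α² given I = x. -/
open MeasureTheory Real

noncomputable section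

/-- The function `t ↦ t * exp (-t² / (2α²))` is bounded above by `α`. -/
lemma mul_exp_neg_sq_div_le {α : ℝ} (hα : 0 < α) (t : ℝ) :
    t * Real.exp (-t ^ 2 / (2 * α ^ 2)) ≤ α := by
  have h : t ≤ α * (t ^ 2 / (2 * α ^ 2) + 1) := by
    rw [← sub_nonneg]
    have : α * (t ^ 2 / (2 * α ^ 2) + 1) - t = ((t - α) ^ 2 + α ^ 2) / (2 * α) := by
      field_simp
      ring
    rw [this]
    positivity
  have hexp : t ≤ α * Real.exp (t ^ 2 / (2 * α ^ 2)) :=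
    h.trans (by gcongr; exact Real.add_one_le_exp _)
  rw [neg_div, Real.exp_neg, ← div_eq_mul_inv]
  exact (div_le_iff₀ (Real.exp_pos _)).2 hexp

section GaussianKernel

variable {E : Type*} [NormedAddCommGroup E] [InnerProductSpace ℝ E]

/-- The gradient of a Gaussian function centred at `m`. -/
lemma hasGradientAt_gaussian [CompleteSpace E] (c α : ℝ) (m x : E) :
    HasGradientAt (fun z => c * Real.exp (-‖z - m‖ ^ 2 / (2 * α ^ 2)))
      ((c * Real.exp (-‖x - m‖ ^ 2 / (2 * α ^ 2)) / α ^ 2) • (m - x)) x := by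
  rw [hasGradientAt_iff_hasFDerivAt]
  have h := ((((hasFDerivAt_id x).sub_const m).norm_sq.neg.mul_const
    (2 * α ^ 2)⁻¹).exp.const_mul c)
  simp only [← div_eq_mul_inv] at h
  refine h.congr_fderiv ?_
  ext v
  rw [← neg_sub x m]
  simp [-neg_sub]
  ring

/-- The gradient of a Gaussian function is bounded. -/
lemma norm_gradient_gaussian_le {c α : ℝ} (hc : 0 ≤ c) (hα : 0 < α) (m x : E) :
    ‖(c * Real.exp (-‖x - m‖ ^ 2 / (2 * α ^ 2)) / α ^ 2) • (m - x)‖ ≤ c / α := by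
  rw [norm_smul, Real.norm_of_nonneg (by positivity), norm_sub_rev m x]
  calc _ = c / α ^ 2 * (‖x - m‖ * Real.exp (-‖x - m‖ ^ 2 / (2 * α ^ 2))) := by ring
    _ ≤ c / α ^ 2 * α := by gcongr; exact mul_exp_neg_sq_div_le hα _
    _ = c / α := by field_simp

end GaussianKernel

/-- **Tweedie's formula for the interpolant density.** The Gaussian-smoothed
density `p(x) = ∫ K(x, y) dρ₁(y)` is strictly positive and continuously
differentiable, with gradient `∇p(x) = ∫ ((βy − x)/α²) K(x, y) dρ₁(y)`; hence
the score satisfies `∇ log p(x) = (∫ ((βy − x)/α²) K(x, y) dρ₁(y)) / p(x)`. -/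
theorem stmt_11
    {d : ℕ} (α β : ℝ) (hα : 0 < α)
    (ρ₁ : Measure (EuclideanSpace ℝ (Fin d))) [IsProbabilityMeasure ρ₁]
    (K : EuclideanSpace ℝ (Fin d) → EuclideanSpace ℝ (Fin d) → ℝ)
    (hK : ∀ x y, K x y = (2 * Real.pi * α ^ 2) ^ (-(d : ℝ) / 2) *
      Real.exp (-‖x - β • y‖ ^ 2 / (2 * α ^ 2)))
    (p : EuclideanSpace ℝ (Fin d) → ℝ)
    (hp : ∀ x, p x = ∫ y, K x y ∂ρ₁) :
    (∀ x, 0 < p x) ∧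
    ContDiff ℝ 1 p ∧
    (∀ x, HasGradientAt p (∫ y, (K x y / α ^ 2) • (β • y - x) ∂ρ₁) x) ∧
    (∀ x, HasGradientAt (fun z => Real.log (p z))
      ((p x)⁻¹ • ∫ y, (K x y / α ^ 2) • (β • y - x) ∂ρ₁) x) := by
  obtain rfl : p = fun x => ∫ y, K x y ∂ρ₁ := funext hp
  set c : ℝ := (2 * Real.pi * α ^ 2) ^ (-(d : ℝ) / 2)
  have hc : 0 < c := by positivity
  have hKpos : ∀ x y, 0 < K x y := fun x y => by rw [hK]; positivity
  have hKcont : Continuous fun q : _ × _ => K q.1 q.2 := by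
    simp only [hK]
    fun_prop
  have hGcont : Continuous fun q : EuclideanSpace ℝ (Fin d) × EuclideanSpace ℝ (Fin d) =>
      (K q.1 q.2 / α ^ 2) • (β • q.2 - q.1) := by
    fun_prop
  have hbound : ∀ x y, ‖(K x y / α ^ 2) • (β • y - x)‖ ≤ c / α := fun x y => by
    rw [hK]
    exact norm_gradient_gaussian_le hc.le hα _ _
  have hKint : ∀ x, Integrable (K x) ρ₁ := fun x => by
    refine Integrable.of_bound (hKcont.comp (.prodMk_right x)).aestronglyMeasurable c
      (.of_forall fun y => ?_)
    rw [Real.norm_of_nonneg (hKpos x y).le, hK]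
    refine mul_le_of_le_one_right hc.le (Real.exp_le_one_iff.2 ?_)
    rw [neg_div, neg_nonpos]
    positivity
  have hGmeas : ∀ x, AEStronglyMeasurable (fun y => (K x y / α ^ 2) • (β • y - x)) ρ₁ :=
    fun x => (hGcont.comp (.prodMk_right x)).aestronglyMeasurable
  have hppos : ∀ x, 0 < ∫ y, K x y ∂ρ₁ := fun x => by
    rw [integral_pos_iff_support_of_nonneg (fun y => (hKpos x y).le) (hKint x)]
    have : Function.support (K x) = Set.univ :=
      Set.eq_univ_of_forall fun y => (hKpos x y).ne'
    simp [this]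
  have hgrad : ∀ x, HasGradientAt (fun x => ∫ y, K x y ∂ρ₁)
      (∫ y, (K x y / α ^ 2) • (β • y - x) ∂ρ₁) x := fun x => by
    let D := InnerProductSpace.toDual ℝ (EuclideanSpace ℝ (Fin d))
    rw [hasGradientAt_iff_hasFDerivAt]
    have h := hasFDerivAt_integral_of_dominated_of_fderiv_le (μ := ρ₁) (𝕜 := ℝ)
      (F := K) (F' := fun z y => D ((K z y / α ^ 2) • (β • y - z)))
      (x₀ := x) (bound := fun _ => c / α) Filter.univ_mem
      (.of_forall fun z => (hKint z).aestronglyMeasurable) (hKint x)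
      (D.continuous.comp_aestronglyMeasurable (hGmeas x))
      (.of_forall fun y z _ => by rw [D.norm_map]; exact hbound z y)
      (integrable_const _)
      (.of_forall fun y z _ => by
        simp only [hK]
        exact hasGradientAt_iff_hasFDerivAt.1 (hasGradientAt_gaussian c α (β • y) z))
    exact h.congr_fderiv (D.toContinuousLinearEquiv.integral_comp_comm _)
  refine ⟨hppos, ?_, hgrad, fun x => ?_⟩
  · refine contDiff_one_iff_hasFDerivAt.2 ⟨_, ?_, fun x => (hgrad x).hasFDerivAt⟩
    refine (LinearIsometryEquiv.continuous _).comp ?_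
    exact continuous_of_dominated hGmeas (fun x => .of_forall (hbound x)) (integrable_const _)
      (.of_forall fun y => hGcont.comp (.prodMk_left y))
  · rw [hasGradientAt_iff_hasFDerivAt]
    refine ((hgrad x).hasFDerivAt.log (hppos x).ne').congr_fderiv ?_
    simp
end
end

section
/- Let r : ℝ^d → ℝ be bounded measurable and define F(x) := (∫ r(y) K(x, y) dρ₁(y)) / p(x), which is the conditional expectation of r(x₁) given I = x. Then F is continuously differentiable on ℝ^d and its gradient equals (β/α²) times the conditional covariance of r(x₁) and x₁ given I = x: ∇F(x) = (β/α²) ( (∫ y r(y) K(x,y) dρ₁(y))/p(x) − F(x) · (∫ y K(x,y) dρ₁(y))/p(x) ), where the two ratios are the posterior means of x₁ r(x₁) and of x₁ under the probability measure with density K(x, ·)/p(x) with respect to ρ₁. -/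
open MeasureTheory Real

noncomputable section

section GaussianKernel

variable {E : Type*} [NormedAddCommGroup E]

/-- A constant multiple of the Gaussian density of scale `α`. -/
def gaussianBump (c α : ℝ) (u : E) : ℝ :=
  c * Real.exp (-‖u‖ ^ 2 / (2 * α ^ 2))

lemma continuous_gaussianBump (c α : ℝ) : Continuous (gaussianBump c α : E → ℝ) := by
  unfold gaussianBump
  fun_prop

lemma gaussianBump_pos {c : ℝ} (hc : 0 < c) (α : ℝ) (u : E) : 0 < gaussianBump c α u :=
  mul_pos hc (Real.exp_pos _)

lemma abs_gaussianBump_le (c α : ℝ) (u : E) : |gaussianBump c α u| ≤ |c| := by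
  rw [gaussianBump, abs_mul, abs_of_pos (Real.exp_pos _)]
  refine mul_le_of_le_one_right (abs_nonneg c) (Real.exp_le_one_iff.2 ?_)
  rw [neg_div]
  exact neg_nonpos.2 (by positivity)

variable [InnerProductSpace ℝ E]

lemma norm_gaussianBump_smul_le (c : ℝ) {α : ℝ} (hα : 0 < α) (u : E) :
    ‖gaussianBump c α u • u‖ ≤ |c| * α := by
  have hle : ‖u‖ ≤ α * Real.exp (‖u‖ ^ 2 / (2 * α ^ 2)) := by
    have h1 := Real.add_one_le_exp (‖u‖ ^ 2 / (2 * α ^ 2))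
    have h2 : ‖u‖ ≤ α * (‖u‖ ^ 2 / (2 * α ^ 2) + 1) := by
      have h3 : α * (‖u‖ ^ 2 / (2 * α ^ 2) + 1) - ‖u‖
          = ((‖u‖ - α) ^ 2 + α ^ 2) / (2 * α) := by
        field_simp
        ring
      have h4 : 0 ≤ ((‖u‖ - α) ^ 2 + α ^ 2) / (2 * α) := by positivity
      linarith
    exact h2.trans (mul_le_mul_of_nonneg_left h1 hα.le)
  rw [norm_smul, gaussianBump, Real.norm_eq_abs, abs_mul, abs_of_pos (Real.exp_pos _), mul_assoc]
  refine mul_le_mul_of_nonneg_left ?_ (abs_nonneg c)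
  calc Real.exp (-‖u‖ ^ 2 / (2 * α ^ 2)) * ‖u‖
      ≤ Real.exp (-‖u‖ ^ 2 / (2 * α ^ 2)) * (α * Real.exp (‖u‖ ^ 2 / (2 * α ^ 2))) :=
        mul_le_mul_of_nonneg_left hle (Real.exp_pos _).le
    _ = α := by rw [mul_left_comm, ← Real.exp_add, neg_div, neg_add_cancel, Real.exp_zero, mul_one]

lemma hasFDerivAt_gaussianBump_sub (c α : ℝ) (b x : E) :
    HasFDerivAt (fun z => gaussianBump c α (z - b))
      (innerSL ℝ (-(α ^ 2)⁻¹ • gaussianBump c α (x - b) • (x - b))) x := by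
  have h1 : HasFDerivAt (fun z : E => ‖z - b‖ ^ 2) (2 • innerSL ℝ (x - b)) x := by
    simpa using ((hasFDerivAt_id x).sub_const b).norm_sq
  have h2 := ((h1.const_mul (-(2 * α ^ 2)⁻¹)).exp).const_mul c
  have hfun : (fun z => gaussianBump c α (z - b)) =
      fun z => c * Real.exp (-(2 * α ^ 2)⁻¹ * ‖z - b‖ ^ 2) := by
    funext z
    rw [gaussianBump, neg_div, div_eq_inv_mul, neg_mul]
  rw [hfun]
  refine h2.congr_fderiv ?_
  ext v
  rw [show gaussianBump c α (x - b) = _ from congrFun hfun x]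
  simp only [smul_apply, innerSL_apply_apply, real_inner_smul_left, smul_eq_mul, nsmul_eq_mul]
  push_cast
  ring

section Mixture

variable {f : E → ℝ} {C : ℝ}

lemma norm_mul_gaussianBump_smul_le (hfC : ∀ y, |f y| ≤ C) (c β : ℝ) {α : ℝ} (hα : 0 < α)
    (x y : E) :
    ‖(f y * gaussianBump c α (x - β • y)) • (x - β • y)‖ ≤ C * (|c| * α) := by
  rw [mul_smul, norm_smul]
  exact mul_le_mul (hfC y) (norm_gaussianBump_smul_le c hα _) (norm_nonneg _)
    ((abs_nonneg _).trans (hfC y))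

variable [MeasurableSpace E] [BorelSpace E] {μ : Measure E}

lemma integrable_mul_gaussianBump [IsFiniteMeasure μ] (hf : Measurable f) (hfC : ∀ y, |f y| ≤ C)
    (c α β : ℝ) (x : E) :
    Integrable (fun y => f y * gaussianBump c α (x - β • y)) μ := by
  have hk := (continuous_gaussianBump (E := E) c α).measurable
  refine Integrable.of_bound (C := C * |c|) (by fun_prop) (.of_forall fun y => ?_)
  rw [norm_mul]
  exact mul_le_mul (hfC y) (abs_gaussianBump_le c α _) (abs_nonneg _)
    ((abs_nonneg _).trans (hfC y))

variable [SecondCountableTopology E]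

lemma aestronglyMeasurable_mul_gaussianBump_smul (hf : Measurable f) (c α β : ℝ) (x : E) :
    AEStronglyMeasurable (fun y => (f y * gaussianBump c α (x - β • y)) • (x - β • y)) μ := by
  have hk := (continuous_gaussianBump (E := E) c α).measurable
  have : Measurable fun y => (f y * gaussianBump c α (x - β • y)) • (x - β • y) := by fun_prop
  exact this.aestronglyMeasurable

variable [IsFiniteMeasure μ]

lemma integrable_mul_gaussianBump_smul (hf : Measurable f) (hfC : ∀ y, |f y| ≤ C)
    (c β : ℝ) {α : ℝ} (hα : 0 < α) (x : E) :
    Integrable (fun y => (f y * gaussianBump c α (x - β • y)) • (x - β • y)) μ :=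
  Integrable.of_bound (aestronglyMeasurable_mul_gaussianBump_smul hf c α β x) (C * (|c| * α))
    (.of_forall fun y => norm_mul_gaussianBump_smul_le hfC c β hα x y)

lemma continuous_integral_mul_gaussianBump_smul (hf : Measurable f) (hfC : ∀ y, |f y| ≤ C)
    (c β : ℝ) {α : ℝ} (hα : 0 < α) :
    Continuous fun x => ∫ y, (f y * gaussianBump c α (x - β • y)) • (x - β • y) ∂μ := by
  have hk := continuous_gaussianBump (E := E) c α
  refine continuous_of_dominated
    (fun x => aestronglyMeasurable_mul_gaussianBump_smul hf c α β x)
    (fun x => .of_forall fun y => norm_mul_gaussianBump_smul_le hfC c β hα x y)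
    (integrable_const _) (.of_forall fun y => ?_)
  fun_prop

variable [CompleteSpace E]

lemma hasGradientAt_integral_mul_gaussianBump (hf : Measurable f) (hfC : ∀ y, |f y| ≤ C)
    (c β : ℝ) {α : ℝ} (hα : 0 < α) (x : E) :
    HasGradientAt (fun z => ∫ y, f y * gaussianBump c α (z - β • y) ∂μ)
      (-(α ^ 2)⁻¹ • ∫ y, (f y * gaussianBump c α (x - β • y)) • (x - β • y) ∂μ) x := by
  let D : E → E → E := fun z y =>
    -(α ^ 2)⁻¹ • (f y * gaussianBump c α (z - β • y)) • (z - β • y)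
  have hDint (z : E) : Integrable (D z) μ :=
    (integrable_mul_gaussianBump_smul hf hfC c β hα z).smul _
  have hD'meas : AEStronglyMeasurable (fun y => innerSL ℝ (D x y)) μ :=
    (innerSL ℝ).continuous.comp_aestronglyMeasurable (hDint x).aestronglyMeasurable
  have key := hasFDerivAt_integral_of_dominated_of_fderiv_le (μ := μ) (𝕜 := ℝ)
    (F := fun z y => f y * gaussianBump c α (z - β • y))
    (F' := fun z y => innerSL ℝ (D z y)) (x₀ := x) (s := Set.univ)
    (bound := fun _ => (α ^ 2)⁻¹ * (C * (|c| * α))) Filter.univ_mem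
    (.of_forall fun z => (integrable_mul_gaussianBump hf hfC c α β z).aestronglyMeasurable)
    (integrable_mul_gaussianBump hf hfC c α β x) hD'meas
    (.of_forall fun y z _ => by
      rw [innerSL_apply_norm, norm_smul, norm_neg, Real.norm_of_nonneg (by positivity)]
      exact mul_le_mul_of_nonneg_left (norm_mul_gaussianBump_smul_le hfC c β hα z y)
        (by positivity))
    (integrable_const _)
    (.of_forall fun y z _ => by
      refine ((hasFDerivAt_gaussianBump_sub c α (β • y) z).const_mul (f y)).congr_fderiv ?_
      ext v
      simp only [D, smul_apply, innerSL_apply_apply, real_inner_smul_left,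
        smul_eq_mul]
      ring)
  rw [hasGradientAt_iff_hasFDerivAt]
  refine key.congr_fderiv ?_
  have hD'int : Integrable (fun y => innerSL ℝ (D x y)) μ :=
    (hDint x).norm.mono' hD'meas (.of_forall fun y => (innerSL_apply_norm ℝ (D x y)).le)
  ext v
  rw [ContinuousLinearMap.integral_apply hD'int, InnerProductSpace.toDual_apply_apply,
    ← integral_smul, real_inner_comm, ← integral_inner (hDint x)]
  simp only [innerSL_apply_apply, real_inner_comm]

lemma integral_mul_gaussianBump_smul_sub (hf : Measurable f) (hfC : ∀ y, |f y| ≤ C)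
    (c β : ℝ) {α : ℝ} (hα : 0 < α) (x : E) :
    ∫ y, (f y * gaussianBump c α (x - β • y)) • (x - β • y) ∂μ =
      (∫ y, f y * gaussianBump c α (x - β • y) ∂μ) • x -
        β • ∫ y, (f y * gaussianBump c α (x - β • y)) • y ∂μ := by
  have h1 := (integrable_mul_gaussianBump (μ := μ) hf hfC c α β x).smul_const x
  have h2 := integrable_mul_gaussianBump_smul (μ := μ) hf hfC c β hα x
  have h3 : ∫ y, β • (f y * gaussianBump c α (x - β • y)) • y ∂μ =
      (∫ y, (f y * gaussianBump c α (x - β • y)) • x ∂μ) -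
        ∫ y, (f y * gaussianBump c α (x - β • y)) • (x - β • y) ∂μ := by
    rw [← integral_sub h1 h2]
    refine integral_congr_ae (.of_forall fun y => ?_)
    simp only [← smul_sub, sub_sub_cancel]
    rw [smul_comm]
  rw [← integral_smul, h3, integral_smul_const, sub_sub_cancel]

end Mixture

end GaussianKernel

lemma contDiff_one_of_hasGradientAt {E : Type*} [NormedAddCommGroup E] [InnerProductSpace ℝ E]
    [CompleteSpace E] {g : E → ℝ} {g' : E → E} (hg : ∀ x, HasGradientAt g (g' x) x)
    (hg' : Continuous g') : ContDiff ℝ 1 g :=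
  contDiff_one_iff_hasFDerivAt.2 ⟨fun x => InnerProductSpace.toDual ℝ E (g' x),
    (InnerProductSpace.toDual ℝ E).continuous.comp hg', fun x => (hg x).hasFDerivAt⟩

/-- **Gradient of the posterior mean of the reward.** With
`F(x) = (∫ r(y) K(x, y) dρ₁(y)) / p(x)` (the conditional expectation of `r(x₁)`
given `I = x`), `F` is continuously differentiable and
`∇F(x) = (β/α²)((∫ y r(y) K(x,y) dρ₁)/p(x) − F(x) (∫ y K(x,y) dρ₁)/p(x))`. -/
theorem stmt_12
    {d : ℕ} (α β : ℝ) (hα : 0 < α)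
    (ρ₁ : Measure (EuclideanSpace ℝ (Fin d))) [IsProbabilityMeasure ρ₁]
    (K : EuclideanSpace ℝ (Fin d) → EuclideanSpace ℝ (Fin d) → ℝ)
    (hK : ∀ x y, K x y = (2 * Real.pi * α ^ 2) ^ (-(d : ℝ) / 2) *
      Real.exp (-‖x - β • y‖ ^ 2 / (2 * α ^ 2)))
    (p : EuclideanSpace ℝ (Fin d) → ℝ)
    (hp : ∀ x, p x = ∫ y, K x y ∂ρ₁)
    (r : EuclideanSpace ℝ (Fin d) → ℝ)
    (hr : Measurable r) (C : ℝ) (hrC : ∀ x, |r x| ≤ C)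
    (F : EuclideanSpace ℝ (Fin d) → ℝ)
    (hF : ∀ x, F x = (∫ y, r y * K x y ∂ρ₁) / p x) :
    ContDiff ℝ 1 F ∧
    ∀ x, HasGradientAt F
      ((β / α ^ 2) •
        ((p x)⁻¹ • (∫ y, (r y * K x y) • y ∂ρ₁) -
          F x • ((p x)⁻¹ • ∫ y, K x y • y ∂ρ₁))) x := by
  set c : ℝ := (2 * Real.pi * α ^ 2) ^ (-(d : ℝ) / 2)
  have hc : 0 < c := Real.rpow_pos_of_pos (by positivity) _
  have hK' (x y) : K x y = gaussianBump c α (x - β • y) := hK x y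
  obtain rfl : p = fun x => ∫ y, (1 : ℝ) * gaussianBump c α (x - β • y) ∂ρ₁ := by
    funext x
    simp only [hp, hK', one_mul]
  obtain rfl : F = fun x => (∫ y, r y * gaussianBump c α (x - β • y) ∂ρ₁) /
      ∫ y, (1 : ℝ) * gaussianBump c α (x - β • y) ∂ρ₁ := by
    funext x
    simp only [hF, hK']
  have hone : ∀ y : EuclideanSpace ℝ (Fin d), |(1 : ℝ)| ≤ 1 := by simp
  have hN := hasGradientAt_integral_mul_gaussianBump (μ := ρ₁) hr hrC c β hα
  have hP := hasGradientAt_integral_mul_gaussianBump (μ := ρ₁) measurable_const hone c β hα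
  have hNc := continuous_integral_mul_gaussianBump_smul (μ := ρ₁) hr hrC c β hα
  have hPc := continuous_integral_mul_gaussianBump_smul (μ := ρ₁) measurable_const hone c β hα
  have hpos (x : EuclideanSpace ℝ (Fin d)) :
      0 < ∫ y, (1 : ℝ) * gaussianBump c α (x - β • y) ∂ρ₁ := by
    have hint := integrable_mul_gaussianBump (μ := ρ₁) measurable_const hone c α β x
    rw [integral_pos_iff_support_of_nonneg
      (fun y => (mul_pos one_pos (gaussianBump_pos hc α _)).le) hint]
    have : Function.support (fun y => (1 : ℝ) * gaussianBump c α (x - β • y)) = Set.univ :=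
      Set.eq_univ_of_forall fun y => (mul_pos one_pos (gaussianBump_pos hc α _)).ne'
    rw [this]
    simp
  refine ⟨ContDiff.div (contDiff_one_of_hasGradientAt hN (hNc.const_smul (-(α ^ 2)⁻¹)))
    (contDiff_one_of_hasGradientAt hP (hPc.const_smul (-(α ^ 2)⁻¹))) fun x => (hpos x).ne', fun x => ?_⟩
  have hx := (hpos x).ne'
  have hq := (hN x).hasFDerivAt.mul ((hasDerivAt_inv hx).comp_hasFDerivAt x (hP x).hasFDerivAt)
  rw [hasGradientAt_iff_hasFDerivAt]
  simp only [div_eq_mul_inv _ (∫ y, _ ∂ρ₁)]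
  refine hq.congr_fderiv ?_
  rw [integral_mul_gaussianBump_smul_sub hr hrC c β hα,
    integral_mul_gaussianBump_smul_sub measurable_const hone c β hα]
  have hK1 : ∫ y, K x y • y ∂ρ₁ =
      ∫ y, ((1 : ℝ) * gaussianBump c α (x - β • y)) • y ∂ρ₁ := by
    simp only [hK', one_mul]
  have hKr : ∫ y, (r y * K x y) • y ∂ρ₁ =
      ∫ y, (r y * gaussianBump c α (x - β • y)) • y ∂ρ₁ := by
    simp only [hK']
  rw [hK1, hKr]
  ext v
  simp only [smul_apply, add_apply, Function.comp_apply,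
    InnerProductSpace.toDual_apply_apply, real_inner_smul_left, inner_sub_left, smul_eq_mul]
  field_simp
  ring
end
end

section
/- Assume β ≠ 0 and fix reals α', β' (the time derivatives of the interpolant coefficients), a ∈ ℝ, and a bounded measurable reward r : ℝ^d → ℝ. Define g_a(x) := (∫ e^{a r(y)} K(x,y) dρ₁(y)) / p(x) (the exponential of the value function v_a(x) = log E[e^{a r(x₁)} | I = x]), the tilted posterior mean m_a(x) := (∫ y e^{a r(y)} K(x,y) dρ₁(y)) / (∫ e^{a r(y)} K(x,y) dρ₁(y)), and the tilted drift b_a(x) := (α'/α) x + (β' − α' β / α) m_a(x) (which is the conditional expectation of α' x₀ + β' x₁ given I = x under the reward-tilted endpoint law). Set σ²/2 := α² β'/β − α' α. Then for every x ∈ ℝ^d, b_a(x) = b_0(x) + (σ²/2) ∇ log g_a(x); that is, the velocity field learned by Tilt Matching equals the base probability-flow drift plus (σ²/2) times the gradient of the value function, and hence coincides with the drift of the probability flow ODE of the Doob h-transformed diffusion with diffusion coefficient σ. -/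
open MeasureTheory Real

noncomputable section

section GaussianSmoothing

variable {E : Type*} [NormedAddCommGroup E] [InnerProductSpace ℝ E]

/-- The Gaussian kernel with mean `β y` and standard deviation `α`, without its normalization. -/
def gaussianWeight (α β : ℝ) (x y : E) : ℝ :=
  Real.exp (-‖x - β • y‖ ^ 2 / (2 * α ^ 2))

lemma gaussianWeight_pos (α β : ℝ) (x y : E) : 0 < gaussianWeight α β x y :=
  Real.exp_pos _

lemma gaussianWeight_le_one (α β : ℝ) (x y : E) : gaussianWeight α β x y ≤ 1 :=
  Real.exp_le_one_iff.2 (div_nonpos_of_nonpos_of_nonneg (by simp) (by positivity))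

lemma continuous_gaussianWeight (α β : ℝ) (x : E) : Continuous (gaussianWeight α β x) := by
  unfold gaussianWeight
  fun_prop

lemma gaussianWeight_mul_norm_le {α : ℝ} (hα : 0 < α) (β : ℝ) (x y : E) :
    gaussianWeight α β x y * ‖β • y - x‖ ≤ α := by
  rw [norm_sub_rev, gaussianWeight, neg_div, Real.exp_neg, inv_mul_le_iff₀ (Real.exp_pos _)]
  set t := ‖x - β • y‖
  have hexp : t ^ 2 / (2 * α ^ 2) + 1 ≤ Real.exp (t ^ 2 / (2 * α ^ 2)) := Real.add_one_le_exp _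
  refine le_trans ?_ (mul_le_mul_of_nonneg_right hexp hα.le)
  have hsq : (t ^ 2 / (2 * α ^ 2) + 1) * α - t = ((t - α) ^ 2 + α ^ 2) / (2 * α) := by
    field_simp
    ring
  have hnonneg : 0 ≤ ((t - α) ^ 2 + α ^ 2) / (2 * α) := by positivity
  linarith

lemma norm_gaussianWeight_smul_le {α : ℝ} (hα : 0 < α) (β : ℝ) (x y : E) (c : ℝ) :
    ‖(c * gaussianWeight α β x y) • (β • y - x)‖ ≤ |c| * α := by
  rw [norm_smul, norm_mul, Real.norm_eq_abs, Real.norm_eq_abs,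
    abs_of_pos (gaussianWeight_pos α β x y), mul_assoc]
  exact mul_le_mul_of_nonneg_left (gaussianWeight_mul_norm_le hα β x y) (abs_nonneg c)

lemma hasGradientAt_gaussianWeight [CompleteSpace E] (α β : ℝ) (x y : E) :
    HasGradientAt (gaussianWeight α β · y)
      ((gaussianWeight α β x y / α ^ 2) • (β • y - x)) x := by
  rw [hasGradientAt_iff_hasFDerivAt]
  have h := ((((hasFDerivAt_id x).sub_const (β • y)).norm_sq.neg).mul_const
    (2 * α ^ 2)⁻¹).exp
  refine h.congr_fderiv ?_
  ext v
  simp only [id_eq, Pi.neg_apply, smul_apply, neg_apply,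
    ContinuousLinearMap.comp_apply, ContinuousLinearMap.id_apply, innerSL_apply_apply,
    InnerProductSpace.toDual_apply_apply, inner_smul_left, smul_eq_mul, gaussianWeight,
    ← neg_sub x (β • y), inner_neg_left, div_eq_mul_inv, mul_inv, nsmul_eq_mul]
  simp
  ring

variable [MeasurableSpace E] [BorelSpace E] {μ : Measure E} {w : E → ℝ}

lemma integrable_mul_gaussianWeight (hw : Integrable w μ) (α β : ℝ) (x : E) :
    Integrable (fun y ↦ w y * gaussianWeight α β x y) μ :=
  hw.mul_bdd (c := 1) (continuous_gaussianWeight α β x).aestronglyMeasurable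
    (.of_forall fun y ↦ by
      simpa [abs_of_pos (gaussianWeight_pos α β x y)] using gaussianWeight_le_one α β x y)

lemma integral_mul_gaussianWeight_pos [NeZero μ] (hw : Integrable w μ) (hpos : ∀ y, 0 < w y)
    (α β : ℝ) (x : E) : 0 < ∫ y, w y * gaussianWeight α β x y ∂μ := by
  have hprod (y : E) : 0 < w y * gaussianWeight α β x y :=
    mul_pos (hpos y) (gaussianWeight_pos α β x y)
  rw [integral_pos_iff_support_of_nonneg (fun y ↦ (hprod y).le)
    (integrable_mul_gaussianWeight hw α β x),
    Set.eq_univ_of_forall fun y ↦ Function.mem_support.2 (hprod y).ne']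
  exact NeZero.pos _

variable [SecondCountableTopology E]

lemma integrable_gaussianWeight_smul_sub (hw : Integrable w μ) {α : ℝ} (hα : 0 < α) (β : ℝ)
    (x : E) : Integrable (fun y ↦ (w y * gaussianWeight α β x y) • (β • y - x)) μ :=
  (hw.abs.mul_const α).mono'
    ((integrable_mul_gaussianWeight hw α β x).aestronglyMeasurable.smul
      (by fun_prop : Continuous fun y : E ↦ β • y - x).aestronglyMeasurable)
    (.of_forall fun y ↦ norm_gaussianWeight_smul_le hα β x y (w y))

variable [CompleteSpace E]

lemma hasGradientAt_integral_mul_gaussianWeight (hw : Integrable w μ) {α : ℝ} (hα : 0 < α)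
    (β : ℝ) (x : E) :
    HasGradientAt (fun z ↦ ∫ y, w y * gaussianWeight α β z y ∂μ)
      ((α ^ 2)⁻¹ • ∫ y, (w y * gaussianWeight α β x y) • (β • y - x) ∂μ) x := by
  set F' : E → E → StrongDual ℝ E := fun z y ↦ InnerProductSpace.toDual ℝ E
    ((α ^ 2)⁻¹ • (w y * gaussianWeight α β z y) • (β • y - z)) with hF'
  have hint := (integrable_gaussianWeight_smul_sub hw hα β x).smul (α ^ 2)⁻¹
  rw [hasGradientAt_iff_hasFDerivAt, ← integral_smul]
  refine HasFDerivAt.congr_fderiv ?_ (ContinuousLinearMap.integral_comp_commSL (by simp)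
    (InnerProductSpace.toDual ℝ E).toContinuousLinearEquiv.toContinuousLinearMap hint)
  refine hasFDerivAt_integral_of_dominated_of_fderiv_le (F' := F')
    (bound := fun y ↦ (α ^ 2)⁻¹ * (|w y| * α)) Filter.univ_mem
    (.of_forall fun z ↦ (integrable_mul_gaussianWeight hw α β z).aestronglyMeasurable)
    (integrable_mul_gaussianWeight hw α β x)
    ((InnerProductSpace.toDual ℝ E).continuous.comp_aestronglyMeasurable
      hint.aestronglyMeasurable)
    (.of_forall fun y z _ ↦ ?_) ((hw.abs.mul_const α).const_mul _)
    (.of_forall fun y z _ ↦ ?_)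
  · rw [hF', LinearIsometryEquiv.norm_map, norm_smul, norm_inv, norm_pow, Real.norm_eq_abs, sq_abs]
    exact mul_le_mul_of_nonneg_left (norm_gaussianWeight_smul_le hα β z y (w y)) (by positivity)
  · have h := (hasGradientAt_gaussianWeight α β z y).hasFDerivAt.const_mul (w y)
    refine h.congr_fderiv ?_
    simp only [hF', map_smul, smul_smul]
    congr 1
    ring

/-- Tweedie's formula for the measure `μ` reweighted by `w`. -/
lemma hasGradientAt_log_integral_mul_gaussianWeight [NeZero μ] (hw : Integrable w μ)
    (hpos : ∀ y, 0 < w y) {α β : ℝ} (hα : 0 < α) (hβ : β ≠ 0) (x : E) :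
    HasGradientAt (fun z ↦ Real.log (∫ y, w y * gaussianWeight α β z y ∂μ))
      ((α ^ 2)⁻¹ • (β • ((∫ y, w y * gaussianWeight α β x y ∂μ)⁻¹ •
        ∫ y, (w y * gaussianWeight α β x y) • y ∂μ) - x)) x := by
  have hint := integrable_mul_gaussianWeight hw α β x
  have hZ := integral_mul_gaussianWeight_pos hw hpos α β x
  have hlog := (hasGradientAt_integral_mul_gaussianWeight hw hα β x).hasFDerivAt.log hZ.ne'
  rw [hasGradientAt_iff_hasFDerivAt]
  refine hlog.congr_fderiv ?_
  have hsmul : Integrable (fun y ↦ (w y * gaussianWeight α β x y) • y) μ := by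
    refine (((integrable_gaussianWeight_smul_sub hw hα β x).add
      (hint.smul_const x)).smul β⁻¹).congr (.of_forall fun y ↦ ?_)
    simp only [Pi.smul_apply, Pi.add_apply, ← smul_add, sub_add_cancel]
    rw [smul_comm, inv_smul_smul₀ hβ]
  have hsub : ∫ y, (w y * gaussianWeight α β x y) • (β • y - x) ∂μ =
      β • ∫ y, (w y * gaussianWeight α β x y) • y ∂μ -
        (∫ y, w y * gaussianWeight α β x y ∂μ) • x := by
    rw [← integral_smul, ← integral_smul_const, ← integral_sub (hsmul.fun_smul β) (hint.smul_const x)]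
    exact integral_congr_ae (.of_forall fun y ↦ by simp only [smul_sub, smul_comm β])
  rw [hsub, ← map_smul, smul_comm, smul_sub, inv_smul_smul₀ hZ.ne', smul_comm β]

end GaussianSmoothing

/-- **Doob's probability flow ODE.** With `g_a(x) = (∫ e^{a r(y)} K(x,y) dρ₁)/p(x)`
(the exponential of the value function), tilted posterior mean `m_a`, tilted
drift `b_a(x) = (α'/α) x + (β' − α'β/α) m_a(x)`, and `σ²/2 = α²β'/β − α'α`, the
velocity field learned by Tilt Matching satisfies
`b_a(x) = b_0(x) + (σ²/2) ∇ log g_a(x)` for every `x`. -/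
theorem stmt_13
    {d : ℕ} (α β : ℝ) (hα : 0 < α) (hβ : β ≠ 0)
    (ρ₁ : Measure (EuclideanSpace ℝ (Fin d))) [IsProbabilityMeasure ρ₁]
    (K : EuclideanSpace ℝ (Fin d) → EuclideanSpace ℝ (Fin d) → ℝ)
    (hK : ∀ x y, K x y = (2 * Real.pi * α ^ 2) ^ (-(d : ℝ) / 2) *
      Real.exp (-‖x - β • y‖ ^ 2 / (2 * α ^ 2)))
    (p : EuclideanSpace ℝ (Fin d) → ℝ)
    (hp : ∀ x, p x = ∫ y, K x y ∂ρ₁)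
    (α' β' a : ℝ)
    (r : EuclideanSpace ℝ (Fin d) → ℝ)
    (hr : Measurable r) (C : ℝ) (hrC : ∀ x, |r x| ≤ C)
    (g : ℝ → EuclideanSpace ℝ (Fin d) → ℝ)
    (hg : ∀ c x, g c x = (∫ y, Real.exp (c * r y) * K x y ∂ρ₁) / p x)
    (m : ℝ → EuclideanSpace ℝ (Fin d) → EuclideanSpace ℝ (Fin d))
    (hm : ∀ c x, m c x = (∫ y, Real.exp (c * r y) * K x y ∂ρ₁)⁻¹ •
      ∫ y, (Real.exp (c * r y) * K x y) • y ∂ρ₁)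
    (b : ℝ → EuclideanSpace ℝ (Fin d) → EuclideanSpace ℝ (Fin d))
    (hb : ∀ c x, b c x = (α' / α) • x + (β' - α' * β / α) • m c x)
    (σ2half : ℝ)
    (hσ : σ2half = α ^ 2 * β' / β - α' * α) :
    ∀ x, ∃ v : EuclideanSpace ℝ (Fin d),
      HasGradientAt (fun z => Real.log (g a z)) v x ∧
      b a x = b 0 x + σ2half • v := by
  intro x
  set c₀ : ℝ := (2 * Real.pi * α ^ 2) ^ (-(d : ℝ) / 2)
  have hc₀ : 0 < c₀ := Real.rpow_pos_of_pos (by positivity) _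
  set w : ℝ → EuclideanSpace ℝ (Fin d) → ℝ := fun c y ↦ Real.exp (c * r y) * c₀
  have hwpos (c : ℝ) (y : EuclideanSpace ℝ (Fin d)) : 0 < w c y := mul_pos (Real.exp_pos _) hc₀
  have hw (c : ℝ) : Integrable (w c) ρ₁ := by
    refine Integrable.of_bound (C := Real.exp (|c| * C) * c₀)
      (by fun_prop : Measurable (w c)).aestronglyMeasurable (.of_forall fun y ↦ ?_)
    rw [Real.norm_eq_abs, abs_of_pos (hwpos c y)]
    refine mul_le_mul_of_nonneg_right (Real.exp_le_exp.2 ?_) hc₀.le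
    calc c * r y ≤ |c| * |r y| := (le_abs_self _).trans (abs_mul _ _).le
      _ ≤ |c| * C := mul_le_mul_of_nonneg_left (hrC y) (abs_nonneg c)
  have hwK (c : ℝ) (z y : EuclideanSpace ℝ (Fin d)) :
      Real.exp (c * r y) * K z y = w c y * gaussianWeight α β z y := by
    rw [hK, ← mul_assoc, gaussianWeight]
  have hgrad (c : ℝ) : HasGradientAt
      (fun z ↦ Real.log (∫ y, w c y * gaussianWeight α β z y ∂ρ₁))
      ((α ^ 2)⁻¹ • (β • m c x - x)) x := by
    simpa only [hm, hwK] using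
      hasGradientAt_log_integral_mul_gaussianWeight (hw c) (hwpos c) hα hβ x
  refine ⟨(α ^ 2)⁻¹ • (β • m a x - x) - (α ^ 2)⁻¹ • (β • m 0 x - x), ?_, ?_⟩
  · have hlog : (fun z ↦ Real.log (g a z)) = fun z ↦
        Real.log (∫ y, w a y * gaussianWeight α β z y ∂ρ₁) -
          Real.log (∫ y, w 0 y * gaussianWeight α β z y ∂ρ₁) := by
      funext z
      have hpz : p z = ∫ y, w 0 y * gaussianWeight α β z y ∂ρ₁ := by
        simp only [hp, ← hwK, zero_mul, Real.exp_zero, one_mul]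
      rw [hg, hpz]
      simp only [hwK]
      exact Real.log_div (integral_mul_gaussianWeight_pos (hw a) (hwpos a) α β z).ne'
        (integral_mul_gaussianWeight_pos (hw 0) (hwpos 0) α β z).ne'
    rw [hlog, hasGradientAt_iff_hasFDerivAt, map_sub]
    exact (hgrad a).hasFDerivAt.sub (hgrad 0).hasFDerivAt
  · have hcoef : σ2half * ((α ^ 2)⁻¹ * β) = β' - α' * β / α := by
      rw [hσ]
      field_simp
    rw [hb, hb, ← smul_sub, sub_sub_sub_cancel_right, ← smul_sub, smul_smul, smul_smul,
      mul_assoc, hcoef]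
    module
end
end
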